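/- arXiv:2603.07831 — 4 statements merged into one kernel-verified Lean document; each statement's English description precedes it below -/
import Mathlib

section
/- For every ε > 0, the Huber function h_ε : F → ℝ is differentiable on all of F, and its gradient is given by ∇h_ε(y) = y/ε when ‖y‖ ≤ ε and ∇h_ε(y) = y/‖y‖ when ‖y‖ > ε. -/
/-- The Huber function `h_ε : F → ℝ`. -/
noncomputable def huber {F : Type*} [NormedAddCommGroup F] [InnerProductSpace ℝ F]
    (ε : ℝ) (y : F) : ℝ :=
  if ‖y‖ ≤ ε then ‖y‖ ^ 2 / (2 * ε) else ‖y‖ - ε / 2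

section Huber

variable {F : Type*} [NormedAddCommGroup F] [InnerProductSpace ℝ F]

theorem huber_of_norm_le {ε : ℝ} {y : F} (h : ‖y‖ ≤ ε) : huber ε y = ‖y‖ ^ 2 / (2 * ε) :=
  if_pos h

theorem huber_of_le_norm {ε : ℝ} (hε : 0 < ε) {y : F} (h : ε ≤ ‖y‖) :
    huber ε y = ‖y‖ - ε / 2 := by
  rcases h.eq_or_lt with h | h
  · rw [huber_of_norm_le h.ge, ← h]
    field_simp
    ring
  · exact if_neg h.not_ge

variable [CompleteSpace F]

theorem hasGradientAt_norm_sq_div (ε : ℝ) (y : F) :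
    HasGradientAt (fun x : F => ‖x‖ ^ 2 / (2 * ε)) (ε⁻¹ • y) y := by
  rw [hasGradientAt_iff_hasFDerivAt]
  have h := (hasStrictFDerivAt_norm_sq y).hasFDerivAt.mul_const (2 * ε)⁻¹
  simp only [← div_eq_mul_inv] at h
  refine h.congr_fderiv ?_
  ext v
  simp
  ring

theorem hasGradientAt_norm {y : F} (hy : y ≠ 0) :
    HasGradientAt (fun x : F => ‖x‖) (‖y‖⁻¹ • y) y := by
  rw [hasGradientAt_iff_hasFDerivAt]
  have hy' : ‖y‖ ≠ 0 := norm_ne_zero_iff.mpr hy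
  have h := (hasStrictFDerivAt_norm_sq y).hasFDerivAt.sqrt (pow_ne_zero 2 hy')
  simp only [Real.sqrt_sq (norm_nonneg _)] at h
  refine h.congr_fderiv ?_
  ext v
  simp
  ring

theorem hasGradientAt_norm_sub_const {y : F} (hy : y ≠ 0) (c : ℝ) :
    HasGradientAt (fun x : F => ‖x‖ - c) (‖y‖⁻¹ • y) y :=
  (hasGradientAt_norm hy).hasFDerivAt.sub_const c |>.congr_fderiv rfl

theorem hasGradientAt_huber {ε : ℝ} (hε : 0 < ε) (y : F) :
    HasGradientAt (huber ε) (if ‖y‖ ≤ ε then ε⁻¹ • y else ‖y‖⁻¹ • y) y := by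
  rcases lt_trichotomy ‖y‖ ε with h | h | h
  · rw [if_pos h.le]
    refine (hasGradientAt_norm_sq_div ε y).congr_of_eventuallyEq ?_
    filter_upwards [continuous_norm.continuousAt.eventually_lt continuousAt_const h] with x hx
    exact huber_of_norm_le hx.le
  · have hy : y ≠ 0 := norm_pos_iff.mp (h ▸ hε)
    have h_inner : HasFDerivWithinAt (huber ε) (InnerProductSpace.toDual ℝ F (ε⁻¹ • y))
        {x : F | ‖x‖ ≤ ε} y :=
      (hasGradientAt_norm_sq_div ε y).hasFDerivAt.hasFDerivWithinAt.congr
        (fun x hx => huber_of_norm_le hx) (huber_of_norm_le h.le)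
    have h_outer : HasFDerivWithinAt (huber ε) (InnerProductSpace.toDual ℝ F (ε⁻¹ • y))
        {x : F | ε ≤ ‖x‖} y := by
      have := (hasGradientAt_norm_sub_const hy (ε / 2)).hasFDerivAt.hasFDerivWithinAt.congr
        (s := {x : F | ε ≤ ‖x‖}) (fun x hx => huber_of_le_norm hε hx)
        (huber_of_le_norm hε h.ge)
      rwa [h] at this
    have h_cover : {x : F | ‖x‖ ≤ ε} ∪ {x : F | ε ≤ ‖x‖} = Set.univ :=
      Set.eq_univ_of_forall fun x => le_total ‖x‖ ε
    rw [if_pos h.le, hasGradientAt_iff_hasFDerivAt, ← hasFDerivWithinAt_univ, ← h_cover]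
    exact h_inner.union h_outer
  · rw [if_neg h.not_ge]
    have hy : y ≠ 0 := norm_pos_iff.mp (hε.trans h)
    refine (hasGradientAt_norm_sub_const hy (ε / 2)).congr_of_eventuallyEq ?_
    filter_upwards [continuousAt_const.eventually_lt continuous_norm.continuousAt h] with x hx
    exact huber_of_le_norm hε hx.le

end Huber

/-- For every `ε > 0`, the Huber function is differentiable everywhere and its gradient is
`y/ε` when `‖y‖ ≤ ε` and `y/‖y‖` when `‖y‖ > ε`. -/
theorem huber_differentiable_and_gradient
    {F : Type*} [NormedAddCommGroup F] [InnerProductSpace ℝ F] [CompleteSpace F]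
    (ε : ℝ) (hε : 0 < ε) (y : F) :
    DifferentiableAt ℝ (huber ε) y ∧
      gradient (huber ε) y = if ‖y‖ ≤ ε then ε⁻¹ • y else ‖y‖⁻¹ • y :=
  ⟨(hasGradientAt_huber hε y).differentiableAt, (hasGradientAt_huber hε y).gradient⟩
end

section
/- Suppose each q_k : E → F is differentiable. Then for every ε > 0 the smoothed regularizer r_ε is differentiable at every x ∈ E, and its derivative in any direction h ∈ E is given by Dr_ε(x)[h] = Σ_{k : ‖q_k(x)‖ ≤ ε} ⟨q_k(x), Dq_k(x)h⟩/ε + Σ_{k : ‖q_k(x)‖ > ε} ⟨q_k(x), Dq_k(x)h⟩/‖q_k(x)‖. -/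
/-- The quadratic branch of the Huber function, as a differentiable function. -/
theorem hasFDerivAt_norm_sq_div_two_mul {F : Type*} [NormedAddCommGroup F]
    [InnerProductSpace ℝ F] (ε : ℝ) (y : F) :
    HasFDerivAt (fun z : F => ‖z‖ ^ 2 / (2 * ε)) (ε⁻¹ • innerSL ℝ y) y := by
  have h := (hasStrictFDerivAt_norm_sq y).hasFDerivAt.const_mul (2 * ε)⁻¹
  refine (h.congr_fderiv ?_).congr_of_eventuallyEq (.of_forall fun z => ?_)
  · ext v
    simp only [smul_apply, smul_eq_mul, nsmul_eq_mul, mul_inv]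
    push_cast
    ring
  · exact div_eq_inv_mul _ _

/-- The norm of a real inner product space is differentiable away from the origin. -/
theorem hasFDerivAt_norm_of_ne_zero {F : Type*} [NormedAddCommGroup F]
    [InnerProductSpace ℝ F] {y : F} (hy : y ≠ 0) :
    HasFDerivAt (fun z : F => ‖z‖) (‖y‖⁻¹ • innerSL ℝ y) y := by
  have h := (hasStrictFDerivAt_norm_sq y).hasFDerivAt.sqrt (by simpa using hy)
  simp only [Real.sqrt_sq (norm_nonneg _)] at h
  refine h.congr_fderiv ?_
  ext v
  simp only [smul_apply, smul_eq_mul, nsmul_eq_mul, one_div, mul_inv]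
  push_cast
  ring

theorem hasFDerivAt_huber {F : Type*} [NormedAddCommGroup F] [InnerProductSpace ℝ F]
    {ε : ℝ} (hε : 0 < ε) (y : F) :
    HasFDerivAt (huber ε) ((if ‖y‖ ≤ ε then ε⁻¹ else ‖y‖⁻¹) • innerSL ℝ y) y := by
  have hin : ∀ z : F, ‖z‖ ≤ ε → huber ε z = ‖z‖ ^ 2 / (2 * ε) := fun z hz => if_pos hz
  have hout : ∀ z : F, ε ≤ ‖z‖ → huber ε z = ‖z‖ - ε / 2 := by
    intro z hz
    rcases hz.eq_or_lt with h | h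
    · rw [hin z h.ge, ← h]
      field_simp
      ring
    · exact if_neg h.not_ge
  have hnorm (hy : ε ≤ ‖y‖) :
      HasFDerivAt (fun z : F => ‖z‖ - ε / 2) (‖y‖⁻¹ • innerSL ℝ y) y :=
    (hasFDerivAt_norm_of_ne_zero (norm_pos_iff.mp (hε.trans_le hy))).sub_const _
  rcases lt_trichotomy ‖y‖ ε with hy | hy | hy
  · rw [if_pos hy.le]
    refine (hasFDerivAt_norm_sq_div_two_mul ε y).congr_of_eventuallyEq ?_
    filter_upwards [continuous_norm.continuousAt.eventually_lt_const hy] with z hz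
    exact hin z hz.le
  · rw [if_pos hy.le, ← hasFDerivWithinAt_univ]
    have h₁ : HasFDerivWithinAt (huber ε) (ε⁻¹ • innerSL ℝ y) {z | ‖z‖ ≤ ε} y :=
      (hasFDerivAt_norm_sq_div_two_mul ε y).hasFDerivWithinAt.congr hin (hin y hy.le)
    have h₂ : HasFDerivWithinAt (huber ε) (ε⁻¹ • innerSL ℝ y) {z | ε ≤ ‖z‖} y := by
      have h := (hnorm hy.ge).hasFDerivWithinAt.congr (s := {z | ε ≤ ‖z‖}) hout (hout y hy.ge)
      rwa [hy] at h
    exact (h₁.union h₂).mono fun z _ => le_total ‖z‖ ε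
  · rw [if_neg hy.not_ge]
    refine (hnorm hy.le).congr_of_eventuallyEq ?_
    filter_upwards [continuous_norm.continuousAt.eventually_const_lt hy] with z hz
    exact hout z hz.le

open scoped RealInnerProductSpace in
/-- If each `q_k` is differentiable, then `r_ε` is differentiable at every `x ∈ E` and
`Dr_ε(x)[h] = Σ_{‖q_k(x)‖ ≤ ε} ⟨q_k(x), Dq_k(x)h⟩/ε + Σ_{‖q_k(x)‖ > ε} ⟨q_k(x), Dq_k(x)h⟩/‖q_k(x)‖`. -/
theorem smoothed_regularizer_differentiable_and_deriv
    {E F : Type*} [NormedAddCommGroup E] [InnerProductSpace ℝ E] [FiniteDimensional ℝ E]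
    [NormedAddCommGroup F] [InnerProductSpace ℝ F] [FiniteDimensional ℝ F]
    (d₁ : ℕ) (q : Fin d₁ → E → F)
    (hq : ∀ k, Differentiable ℝ (q k))
    (ε : ℝ) (hε : 0 < ε) (x : E) :
    DifferentiableAt ℝ (fun z => ∑ k, huber ε (q k z)) x ∧
      ∀ h : E,
        fderiv ℝ (fun z => ∑ k, huber ε (q k z)) x h =
          (∑ k ∈ Finset.univ.filter (fun k => ‖q k x‖ ≤ ε),
              ⟪q k x, fderiv ℝ (q k) x h⟫ / ε) +
          (∑ k ∈ Finset.univ.filter (fun k => ¬ ‖q k x‖ ≤ ε),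
              ⟪q k x, fderiv ℝ (q k) x h⟫ / ‖q k x‖) := by
  have hsum := HasFDerivAt.fun_sum (u := Finset.univ) fun k _ =>
    (hasFDerivAt_huber hε (q k x)).comp x (hq k x).hasFDerivAt
  simp only [Function.comp_def] at hsum
  refine ⟨hsum.differentiableAt, fun h => ?_⟩
  rw [hsum.fderiv, Finset.sum_filter, Finset.sum_filter, ← Finset.sum_add_distrib,
    sum_apply]
  refine Finset.sum_congr rfl fun k _ => ?_
  by_cases hk : ‖q k x‖ ≤ ε <;> simp [hk, div_eq_inv_mul]
end

section
/- Let φ : E → ℝ be differentiable, let ε, η₁, η₂, η₃, s̄ > 0, and let (x_t)_{t ≥ 0} be a sequence in E such that for every t one of the following holds: (i) ‖∇φ(x_t)‖ ≤ (1/η₁)‖x_{t+1} − x_t‖ and φ(x_{t+1}) − φ(x_t) ≤ −(η₂/2)‖x_{t+1} − x_t‖²; or (ii) x_{t+1} = x_t − s_t∇φ(x_t) for some s_t ≥ s̄ and φ(x_{t+1}) − φ(x_t) ≤ −(η₃/ε)‖x_{t+1} − x_t‖². Then, with C := max{ε/(η₃ s̄²), 2/(η₁²η₂)}, for every t one has φ(x_{t+1})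 ≤ φ(x_t) and ‖∇φ(x_t)‖² ≤ C·(φ(x_t) − φ(x_{t+1})). -/
/-- If a step of length `d ≥ a * g` decreases the objective by `D ≥ c * d ^ 2`, then `D` is
nonnegative and controls `g ^ 2`. -/
theorem sq_le_mul_of_sufficient_decrease {a c d g D : ℝ} (ha : 0 < a) (hc : 0 < c) (hg : 0 ≤ g)
    (hgd : a * g ≤ d) (hD : c * d ^ 2 ≤ D) : 0 ≤ D ∧ g ^ 2 ≤ 1 / (c * a ^ 2) * D := by
  refine ⟨le_trans (by positivity) hD, ?_⟩
  rw [one_div_mul_eq_div, le_div_iff₀ (by positivity)]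
  calc g ^ 2 * (c * a ^ 2) = c * (a * g) ^ 2 := by ring
    _ ≤ c * d ^ 2 := by gcongr
    _ ≤ D := hD

/-- One iteration of the modified ELDA at fixed smoothing level: if every step is either a
u-branch step (i) or a v-branch step (ii), then the objective is non-increasing and
`‖∇φ(x_t)‖² ≤ C·(φ(x_t) − φ(x_{t+1}))` with `C = max{ε/(η₃ s̄²), 2/(η₁²η₂)}`. -/
theorem elda_iteration_gradient_bound
    {E : Type*} [NormedAddCommGroup E] [InnerProductSpace ℝ E] [FiniteDimensional ℝ E]
    (φ : E → ℝ) (hφ : Differentiable ℝ φ)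
    (ε η₁ η₂ η₃ sb : ℝ) (hε : 0 < ε) (hη₁ : 0 < η₁) (hη₂ : 0 < η₂) (hη₃ : 0 < η₃)
    (hsb : 0 < sb)
    (x : ℕ → E)
    (hstep : ∀ t : ℕ,
      (‖gradient φ (x t)‖ ≤ (1 / η₁) * ‖x (t + 1) - x t‖ ∧
        φ (x (t + 1)) - φ (x t) ≤ -(η₂ / 2) * ‖x (t + 1) - x t‖ ^ 2) ∨
      (∃ s : ℝ, sb ≤ s ∧ x (t + 1) = x t - s • gradient φ (x t) ∧
        φ (x (t + 1)) - φ (x t) ≤ -(η₃ / ε) * ‖x (t + 1) - x t‖ ^ 2)) :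
    ∀ t : ℕ, φ (x (t + 1)) ≤ φ (x t) ∧
      ‖gradient φ (x t)‖ ^ 2 ≤
        max (ε / (η₃ * sb ^ 2)) (2 / (η₁ ^ 2 * η₂)) * (φ (x t) - φ (x (t + 1))) := by
  intro t
  rcases hstep t with ⟨hgrad, hdec⟩ | ⟨s, hs, hx, hdec⟩
  · have hgd : η₁ * ‖gradient φ (x t)‖ ≤ ‖x (t + 1) - x t‖ := by
      rwa [one_div_mul_eq_div, le_div_iff₀' hη₁] at hgrad
    obtain ⟨hD, hsq⟩ := sq_le_mul_of_sufficient_decrease hη₁ (half_pos hη₂) (norm_nonneg _) hgd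
      (D := φ (x t) - φ (x (t + 1))) (by linarith)
    refine ⟨sub_nonneg.mp hD, hsq.trans (mul_le_mul_of_nonneg_right ?_ hD)⟩
    refine le_max_of_le_right (le_of_eq ?_)
    field_simp
  · have hgd : sb * ‖gradient φ (x t)‖ ≤ ‖x (t + 1) - x t‖ := by
      have hdiff : x (t + 1) - x t = -(s • gradient φ (x t)) := by rw [hx]; abel
      rw [hdiff, norm_neg, norm_smul, Real.norm_of_nonneg (hsb.le.trans hs)]
      gcongr
    obtain ⟨hD, hsq⟩ := sq_le_mul_of_sufficient_decrease hsb (div_pos hη₃ hε) (norm_nonneg _) hgd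
      (D := φ (x t) - φ (x (t + 1))) (by linarith)
    refine ⟨sub_nonneg.mp hD, hsq.trans (mul_le_mul_of_nonneg_right ?_ hD)⟩
    refine le_max_of_le_left (le_of_eq ?_)
    field_simp
end

section
/- Let f : E → ℝ and, for ε > 0, define φ_ε(x) = f(x) + r_ε(x). Suppose (ε_t)_{t ≥ 0} is a non-increasing sequence of positive reals and (x_t)_{t ≥ 0} is a sequence in E satisfying φ_{ε_t}(x_{t+1}) ≤ φ_{ε_t}(x_t) for every t. Then for every t the merit value satisfies φ_{ε_{t+1}}(x_{t+1}) + d₁ε_{t+1}/2 ≤ φ_{ε_t}(x_t) + d₁ε_t/2, and consequently the original objective φ = f + r satisfies φ(x_t) ≤ φ_{ε_t}(x_t) + d₁ε_t/2 ≤ φ_{ε_0}(x_0) + d₁ε_0/2 for all t. -/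
theorem norm_le_huber_add_half {F : Type*} [NormedAddCommGroup F] [InnerProductSpace ℝ F]
    {ε : ℝ} (hε : 0 < ε) (y : F) : ‖y‖ ≤ huber ε y + ε / 2 := by
  unfold huber
  split_ifs with h
  · have key : ‖y‖ ^ 2 / (2 * ε) + ε / 2 - ‖y‖ = (‖y‖ - ε) ^ 2 / (2 * ε) := by
      field_simp
      ring
    have : 0 ≤ (‖y‖ - ε) ^ 2 / (2 * ε) := by positivity
    linarith
  · linarith

theorem huber_add_half_mono {F : Type*} [NormedAddCommGroup F] [InnerProductSpace ℝ F]
    {δ ε : ℝ} (hδ : 0 < δ) (hδε : δ ≤ ε) (y : F) :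
    huber δ y + δ / 2 ≤ huber ε y + ε / 2 := by
  have hε : 0 < ε := hδ.trans_le hδε
  by_cases h : ‖y‖ ≤ δ
  · rw [huber, huber, if_pos h, if_pos (h.trans hδε)]
    have key : ‖y‖ ^ 2 / (2 * ε) + ε / 2 - (‖y‖ ^ 2 / (2 * δ) + δ / 2)
        = (ε - δ) * (ε * δ - ‖y‖ ^ 2) / (2 * ε * δ) := by
      field_simp
      ring
    have hsq : ‖y‖ ^ 2 ≤ ε * δ := by
      rw [sq]
      exact mul_le_mul (h.trans hδε) h (norm_nonneg y) hε.le
    have : 0 ≤ (ε - δ) * (ε * δ - ‖y‖ ^ 2) / (2 * ε * δ) :=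
      div_nonneg (mul_nonneg (sub_nonneg.2 hδε) (sub_nonneg.2 hsq)) (by positivity)
    linarith
  · have := norm_le_huber_add_half hε y
    rw [huber, if_neg h]
    linarith

theorem sum_huber_add_half {F ι : Type*} [NormedAddCommGroup F] [InnerProductSpace ℝ F]
    [Fintype ι] (ε : ℝ) (y : ι → F) :
    ∑ k, (huber ε (y k) + ε / 2) = ∑ k, huber ε (y k) + (Fintype.card ι : ℝ) * ε / 2 := by
  simp [Finset.sum_add_distrib, mul_div_assoc]

/-- If `(ε_t)` is non-increasing and positive, and `φ_{ε_t}(x_{t+1}) ≤ φ_{ε_t}(x_t)` for all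
`t`, then the merit value `φ_{ε_t}(x_t) + d₁ε_t/2` is non-increasing and the original
objective `φ = f + r` satisfies `φ(x_t) ≤ φ_{ε_t}(x_t) + d₁ε_t/2 ≤ φ_{ε_0}(x_0) + d₁ε_0/2`. -/
theorem merit_monotone_and_objective_bound
    {E F : Type*} [NormedAddCommGroup E] [InnerProductSpace ℝ E] [FiniteDimensional ℝ E]
    [NormedAddCommGroup F] [InnerProductSpace ℝ F] [FiniteDimensional ℝ F]
    (d₁ : ℕ) (q : Fin d₁ → E → F) (f : E → ℝ)
    (ε : ℕ → ℝ) (hεpos : ∀ t, 0 < ε t) (hεmono : ∀ t, ε (t + 1) ≤ ε t)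
    (x : ℕ → E)
    (hdec : ∀ t : ℕ,
      f (x (t + 1)) + (∑ k, huber (ε t) (q k (x (t + 1)))) ≤
        f (x t) + (∑ k, huber (ε t) (q k (x t)))) :
    (∀ t : ℕ,
      f (x (t + 1)) + (∑ k, huber (ε (t + 1)) (q k (x (t + 1)))) + (d₁ : ℝ) * ε (t + 1) / 2 ≤
        f (x t) + (∑ k, huber (ε t) (q k (x t))) + (d₁ : ℝ) * ε t / 2) ∧
    (∀ t : ℕ,
      f (x t) + (∑ k, ‖q k (x t)‖) ≤
          f (x t) + (∑ k, huber (ε t) (q k (x t))) + (d₁ : ℝ) * ε t / 2 ∧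
      f (x t) + (∑ k, huber (ε t) (q k (x t))) + (d₁ : ℝ) * ε t / 2 ≤
        f (x 0) + (∑ k, huber (ε 0) (q k (x 0))) + (d₁ : ℝ) * ε 0 / 2) := by
  have hmono : ∀ t : ℕ,
      f (x (t + 1)) + (∑ k, huber (ε (t + 1)) (q k (x (t + 1)))) + (d₁ : ℝ) * ε (t + 1) / 2 ≤
        f (x t) + (∑ k, huber (ε t) (q k (x t))) + (d₁ : ℝ) * ε t / 2 := by
    intro t
    have h := Finset.sum_le_sum fun k (_ : k ∈ Finset.univ) =>
      huber_add_half_mono (hεpos (t + 1)) (hεmono t) (q k (x (t + 1)))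
    rw [sum_huber_add_half, sum_huber_add_half, Fintype.card_fin] at h
    linarith [hdec t]
  refine ⟨hmono, fun t => ⟨?_, ?_⟩⟩
  · have h := Finset.sum_le_sum fun k (_ : k ∈ Finset.univ) =>
      norm_le_huber_add_half (hεpos t) (q k (x t))
    rw [sum_huber_add_half, Fintype.card_fin] at h
    linarith
  · exact antitone_nat_of_succ_le (f := fun t =>
      f (x t) + (∑ k, huber (ε t) (q k (x t))) + (d₁ : ℝ) * ε t / 2) hmono (Nat.zero_le t)
end
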